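/- arXiv:2308.14727 — 7 statements merged into one kernel-verified Lean document; each statement's English description precedes it below -/
import Mathlib

section
/- Let F and C be finite index types, let L be a symmetric positive definite real matrix indexed by F ⊕ C with blocks L_FF, L_FC, L_CF, L_CC, and let X denote the matrix indexed by F ⊕ C whose (C, F) block equals L_CF * L_FF⁻¹ and whose other three blocks are zero. Let ε ≥ 0 and let S̃ be a symmetric real matrix indexed by C with S̃ ≈_ε SC(L, C). Then S̃ is positive definite and the matrix M := (1 - X)ᵀ * (fromBlocks L_FF⁻¹ 0 0 S̃⁻¹) * (1 - X) satisfies M ≈_ε L⁻¹. -/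
open Matrix

/-- The Loewner order: `X ⪯ Y` iff `Y - X` is positive semidefinite. -/
def loewnerLE {n : Type*} [Fintype n] (X Y : Matrix n n ℝ) : Prop :=
  (Y - X).PosSemidef

/-- Spectral approximation: `A ≈_ε B` iff `exp (-ε) • B ⪯ A ⪯ exp ε • B`. -/
def specApprox {n : Type*} [Fintype n] (ε : ℝ) (A B : Matrix n n ℝ) : Prop :=
  loewnerLE (Real.exp (-ε) • B) A ∧ loewnerLE A (Real.exp ε • B)

/-- A block diagonal matrix with positive semidefinite diagonal blocks is positive semidefinite. -/
theorem Matrix.PosSemidef.fromBlocks_diagonal {m n : Type*} [Fintype m] [Fintype n]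
    {A : Matrix m m ℝ} {D : Matrix n n ℝ} (hA : A.PosSemidef) (hD : D.PosSemidef) :
    (fromBlocks A 0 0 D).PosSemidef := by
  refine .of_dotProduct_mulVec_nonneg
    (hA.isHermitian.fromBlocks (by simp) hD.isHermitian) fun x ↦ ?_
  obtain ⟨u, v, rfl⟩ : ∃ u v, x = Sum.elim u v := ⟨x ∘ Sum.inl, x ∘ Sum.inr, by simp⟩
  have hu := hA.dotProduct_mulVec_nonneg u
  have hv := hD.dotProduct_mulVec_nonneg v
  simp only [star_trivial] at hu hv ⊢
  simpa [fromBlocks_mulVec, dotProduct] using add_nonneg hu hv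

/-- Inversion of positive definite matrices is antitone in the Loewner order. -/
theorem loewnerLE.inv {n : Type*} [Fintype n] [DecidableEq n] {A B : Matrix n n ℝ}
    (hA : A.PosDef) (hB : B.PosDef) (h : loewnerLE A B) : loewnerLE B⁻¹ A⁻¹ := by
  have := hA.isUnit.invertible
  have := hB.isUnit.invertible
  have := hA.inv.isUnit.invertible
  have hblock : (fromBlocks B 1 1ᴴ A⁻¹).PosSemidef := by
    rw [PosDef.fromBlocks₂₂ B 1 hA.inv]
    simpa [loewnerLE] using h
  rw [PosDef.fromBlocks₁₁ 1 A⁻¹ hB] at hblock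
  simpa [loewnerLE] using hblock

namespace specApprox

theorem refl {n : Type*} [Fintype n] {A : Matrix n n ℝ} (hA : A.PosSemidef) {ε : ℝ}
    (hε : 0 ≤ ε) : specApprox ε A A := by
  constructor
  · have := hA.smul (sub_nonneg.2 (Real.exp_le_one_iff.2 (neg_nonpos.2 hε)))
    rwa [sub_smul, one_smul] at this
  · have := hA.smul (sub_nonneg.2 (Real.one_le_exp hε))
    rwa [sub_smul, one_smul] at this

theorem posDef {n : Type*} [Fintype n] {A B : Matrix n n ℝ} {ε : ℝ}
    (h : specApprox ε A B) (hB : B.PosDef) : A.PosDef := by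
  simpa using PosDef.add_posSemidef (hB.smul (Real.exp_pos (-ε))) h.1

theorem inv {n : Type*} [Fintype n] [DecidableEq n] {A B : Matrix n n ℝ} {ε : ℝ}
    (h : specApprox ε A B) (hB : B.PosDef) : specApprox ε A⁻¹ B⁻¹ := by
  have hA := h.posDef hB
  have hsmul (t : ℝ) : (Real.exp t • B)⁻¹ = Real.exp (-t) • B⁻¹ := by
    rw [Real.exp_neg]
    exact inv_smul' B (Units.mk0 _ (Real.exp_ne_zero t)) ((isUnit_iff_isUnit_det B).1 hB.isUnit)
  constructor
  · rw [← hsmul]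
    exact h.2.inv hA (hB.smul (Real.exp_pos ε))
  · rw [← neg_neg ε, ← hsmul]
    exact h.1.inv (hB.smul (Real.exp_pos (-ε))) hA

theorem transpose_mul_mul_same {m n : Type*} [Fintype m] [Fintype n] {A B : Matrix n n ℝ} {ε : ℝ}
    (h : specApprox ε A B) (P : Matrix n m ℝ) : specApprox ε (Pᵀ * A * P) (Pᵀ * B * P) := by
  constructor
  · simpa [loewnerLE, Matrix.mul_sub, Matrix.sub_mul] using h.1.conjTranspose_mul_mul_same P
  · simpa [loewnerLE, Matrix.mul_sub, Matrix.sub_mul] using h.2.conjTranspose_mul_mul_same P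

theorem fromBlocks_diagonal {m n : Type*} [Fintype m] [Fintype n] {A B : Matrix m m ℝ}
    {D E : Matrix n n ℝ} {ε : ℝ} (h₁ : specApprox ε A B) (h₂ : specApprox ε D E) :
    specApprox ε (fromBlocks A 0 0 D) (fromBlocks B 0 0 E) := by
  constructor
  · simpa [loewnerLE, sub_eq_add_neg, fromBlocks_smul, fromBlocks_neg, fromBlocks_add]
      using h₁.1.fromBlocks_diagonal h₂.1
  · simpa [loewnerLE, sub_eq_add_neg, fromBlocks_smul, fromBlocks_neg, fromBlocks_add]
      using h₁.2.fromBlocks_diagonal h₂.2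

end specApprox

section SchurComplement

variable {F C : Type*} {A : Matrix F F ℝ} {B : Matrix F C ℝ} {B' : Matrix C F ℝ} {D : Matrix C C ℝ}

theorem Matrix.PosDef.toBlock₁₁ (h : (fromBlocks A B B' D).PosDef) : A.PosDef :=
  h.submatrix (e := Sum.inl) Sum.inl_injective

theorem Matrix.PosDef.toBlock₂₂ (h : (fromBlocks A B B' D).PosDef) : D.PosDef :=
  h.submatrix (e := Sum.inr) Sum.inr_injective

variable [DecidableEq F] [DecidableEq C]

theorem one_sub_fromBlocks_lower (K : Matrix C F ℝ) :
    1 - fromBlocks 0 0 K 0 = fromBlocks (1 : Matrix F F ℝ) 0 (-K) (1 : Matrix C C ℝ) := by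
  rw [← fromBlocks_one, sub_eq_add_neg, fromBlocks_neg, fromBlocks_add]
  simp

variable [Fintype F] [Fintype C]

theorem isUnit_one_sub_fromBlocks_lower (K : Matrix C F ℝ) :
    IsUnit (1 - fromBlocks (0 : Matrix F F ℝ) 0 K (0 : Matrix C C ℝ)) := by
  rw [one_sub_fromBlocks_lower]
  simp

/-- Block elimination of a positive definite matrix by a congruence. -/
theorem Matrix.PosDef.block_elimination (h : (fromBlocks A B B' D).PosDef) :
    (1 - fromBlocks 0 0 (B' * A⁻¹) 0) * fromBlocks A B B' D *
      (1 - fromBlocks 0 0 (B' * A⁻¹) 0)ᵀ = fromBlocks A 0 0 (D - B' * A⁻¹ * B) := by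
  have hA : A.PosDef := h.toBlock₁₁
  have := hA.isUnit.invertible
  obtain ⟨hAt, -, hBt, -⟩ := isHermitian_fromBlocks_iff.1 h.isHermitian
  simp only [IsHermitian, conjTranspose_eq_transpose_of_trivial] at hAt hBt
  rw [one_sub_fromBlocks_lower, fromBlocks_transpose, fromBlocks_multiply, fromBlocks_multiply]
  simp [transpose_nonsing_inv, hAt, hBt, neg_add_eq_sub]

theorem Matrix.PosDef.schurComplement (h : (fromBlocks A B B' D).PosDef) :
    (D - B' * A⁻¹ * B).PosDef := by
  refine PosDef.toBlock₂₂ (A := A) (B := 0) (B' := 0) ?_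
  rw [← h.block_elimination]
  exact (isUnit_one_sub_fromBlocks_lower _).posDef_star_right_conjugate_iff.2 h

theorem Matrix.PosDef.inv_fromBlocks (h : (fromBlocks A B B' D).PosDef) :
    (fromBlocks A B B' D)⁻¹ = (1 - fromBlocks 0 0 (B' * A⁻¹) 0)ᵀ *
      fromBlocks A⁻¹ 0 0 (D - B' * A⁻¹ * B)⁻¹ * (1 - fromBlocks 0 0 (B' * A⁻¹) 0) := by
  have hP := isUnit_one_sub_fromBlocks_lower (B' * A⁻¹)
  have hinv : fromBlocks A⁻¹ 0 0 (D - B' * A⁻¹ * B)⁻¹ =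
      (fromBlocks A 0 0 (D - B' * A⁻¹ * B))⁻¹ := by
    rw [inv_fromBlocks_zero₂₁_of_isUnit_iff _ _ _
      (iff_of_true h.toBlock₁₁.isUnit h.schurComplement.isUnit)]
    simp
  rw [hinv, ← h.block_elimination]
  set P := 1 - fromBlocks (0 : Matrix F F ℝ) 0 (B' * A⁻¹) (0 : Matrix C C ℝ)
  have hdet := (isUnit_iff_isUnit_det P).1 hP
  have hdet' : IsUnit Pᵀ.det := by rwa [det_transpose]
  rw [mul_inv_rev, mul_inv_rev, ← mul_assoc, ← mul_assoc, mul_nonsing_inv _ hdet', one_mul,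
    mul_assoc, nonsing_inv_mul _ hdet, mul_one]

end SchurComplement

/-- If `L = fromBlocks L_FF L_FC L_CF L_CC` is symmetric positive definite, `ε ≥ 0`, and `S̃`
is a symmetric matrix with `S̃ ≈_ε SC(L, C)`, then `S̃` is positive definite and, with `X` the
matrix whose `(C, F)` block is `L_CF * L_FF⁻¹` and whose other blocks are zero, the matrix
`M = (1 - X)ᵀ * (fromBlocks L_FF⁻¹ 0 0 S̃⁻¹) * (1 - X)` satisfies `M ≈_ε L⁻¹`. -/
theorem approx_schur_gives_approx_inverse {F C : Type*} [Fintype F] [Fintype C]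
    [DecidableEq F] [DecidableEq C]
    (LFF : Matrix F F ℝ) (LFC : Matrix F C ℝ) (LCF : Matrix C F ℝ) (LCC : Matrix C C ℝ)
    (hL : (Matrix.fromBlocks LFF LFC LCF LCC).PosDef)
    (ε : ℝ) (hε : 0 ≤ ε)
    (S : Matrix C C ℝ) (hS : S.IsSymm)
    (happrox : specApprox ε S (LCC - LCF * LFF⁻¹ * LFC)) :
    S.PosDef ∧
      specApprox ε
        ((1 - Matrix.fromBlocks 0 0 (LCF * LFF⁻¹) 0)ᵀ *
            Matrix.fromBlocks LFF⁻¹ 0 0 S⁻¹ *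
            (1 - Matrix.fromBlocks 0 0 (LCF * LFF⁻¹) 0))
        (Matrix.fromBlocks LFF LFC LCF LCC)⁻¹ := by
  have hT := hL.schurComplement
  refine ⟨happrox.posDef hT, ?_⟩
  rw [hL.inv_fromBlocks]
  exact ((specApprox.refl hL.toBlock₁₁.inv.posSemidef hε).fromBlocks_diagonal
    (happrox.inv hT)).transpose_mul_mul_same _
end

section
/- Let A and B be symmetric positive definite real n×n matrices with A ≈_ε B for some ε ≥ 0. Then A⁻¹ ≈_ε B⁻¹. -/
open Matrix

/-- Inversion reverses the Loewner order on positive definite matrices. -/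
theorem loewnerLE_inv {n : Type*} [Fintype n] [DecidableEq n] {X Y : Matrix n n ℝ}
    (hX : X.PosDef) (hY : Y.PosDef) (h : loewnerLE X Y) : loewnerLE Y⁻¹ X⁻¹ := by
  have := hX.isUnit.invertible
  have := hY.isUnit.invertible
  have h₁ := PosDef.fromBlocks₁₁ (1 : Matrix n n ℝ) X⁻¹ hY
  have h₂ := PosDef.fromBlocks₂₂ Y (1 : Matrix n n ℝ) hX.inv
  simp only [conjTranspose_one, Matrix.one_mul, Matrix.mul_one, inv_inv_of_invertible] at h₁ h₂
  exact h₁.mp (h₂.mpr h)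

theorem inv_exp_smul {n : Type*} [Fintype n] [DecidableEq n] {B : Matrix n n ℝ}
    (hB : B.PosDef) (t : ℝ) : (Real.exp t • B)⁻¹ = Real.exp (-t) • B⁻¹ := by
  refine Matrix.inv_eq_right_inv ?_
  rw [smul_mul_smul_comm, Matrix.mul_nonsing_inv _ ((isUnit_iff_isUnit_det B).mp hB.isUnit),
    ← Real.exp_add, add_neg_cancel, Real.exp_zero, one_smul]

/-- Spectral approximation between positive definite matrices is preserved under inversion:
if `A ≈_ε B` with `A, B` symmetric positive definite, then `A⁻¹ ≈_ε B⁻¹`. -/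
theorem specApprox_inv {n : Type*} [Fintype n] [DecidableEq n]
    (ε : ℝ) (hε : 0 ≤ ε)
    (A B : Matrix n n ℝ) (hA : A.PosDef) (hB : B.PosDef)
    (hAB : specApprox ε A B) :
    specApprox ε A⁻¹ B⁻¹ := by
  have h₁ := loewnerLE_inv (hB.smul (Real.exp_pos (-ε))) hA hAB.1
  have h₂ := loewnerLE_inv hA (hB.smul (Real.exp_pos ε)) hAB.2
  rw [inv_exp_smul hB] at h₁ h₂
  rw [neg_neg] at h₁
  exact ⟨h₂, h₁⟩
end

section
/- Let F and C be finite index types and let A and B be symmetric real matrices indexed by F ⊕ C whose (F, F) blocks A_FF and B_FF are both positive definite. If A ⪯ B, then SC(A, C) ⪯ SC(B, C); that is, taking Schur complements onto C is monotone with respect to the Loewner order. -/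
open Matrix

/-- The Schur complement of a matrix `L` indexed by `F ⊕ C` onto `C`:
`SC(L, C) = L_CC - L_CF * L_FF⁻¹ * L_FC`. -/
noncomputable def schurC {F C : Type*} [Fintype F] [DecidableEq F]
    (L : Matrix (F ⊕ C) (F ⊕ C) ℝ) : Matrix C C ℝ :=
  L.toBlocks₂₂ - L.toBlocks₂₁ * (L.toBlocks₁₁)⁻¹ * L.toBlocks₁₂

/-- Subtracting a matrix `S` from the lower right block of a symmetric matrix `L` gives a positive
semidefinite matrix iff `S ⪯ SC(L, C)`. -/
theorem posSemidef_sub_fromBlocks_iff_loewnerLE_schurC {F C : Type*} [Fintype F] [Fintype C]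
    [DecidableEq F] {L : Matrix (F ⊕ C) (F ⊕ C) ℝ} (hL : L.IsSymm)
    (hLFF : L.toBlocks₁₁.PosDef) (S : Matrix C C ℝ) :
    (L - fromBlocks 0 0 0 S).PosSemidef ↔ loewnerLE S (schurC L) := by
  have h₂₁ : L.toBlocks₁₂ᴴ = L.toBlocks₂₁ := by
    ext i j
    exact hL.apply _ _
  let _ := hLFF.isUnit.invertible
  have h := PosDef.fromBlocks₁₁ L.toBlocks₁₂ (L.toBlocks₂₂ - S) hLFF
  have hblocks : fromBlocks L.toBlocks₁₁ L.toBlocks₁₂ L.toBlocks₂₁ (L.toBlocks₂₂ - S) =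
      L - fromBlocks 0 0 0 S := by
    conv_rhs => rw [← fromBlocks_toBlocks L]
    ext (i | i) (j | j) <;> simp
  rw [h₂₁, hblocks] at h
  rw [h, loewnerLE, schurC, sub_right_comm]

/-- **Monotonicity of the Schur complement in the Loewner order.**
If `A` and `B` are symmetric matrices indexed by `F ⊕ C` whose `(F, F)` blocks are positive
definite and `A ⪯ B`, then `SC(A, C) ⪯ SC(B, C)`. -/
theorem schur_complement_monotone {F C : Type*} [Fintype F] [Fintype C] [DecidableEq F]
    (A B : Matrix (F ⊕ C) (F ⊕ C) ℝ) (hA : A.IsSymm) (hB : B.IsSymm)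
    (hAFF : A.toBlocks₁₁.PosDef) (hBFF : B.toBlocks₁₁.PosDef)
    (hAB : loewnerLE A B) :
    loewnerLE (schurC A) (schurC B) := by
  rw [← posSemidef_sub_fromBlocks_iff_loewnerLE_schurC hB hBFF, ← sub_add_sub_cancel B A]
  refine hAB.add ((posSemidef_sub_fromBlocks_iff_loewnerLE_schurC hA hAFF _).mpr ?_)
  rw [loewnerLE, sub_self]
  exact PosSemidef.zero
end

section
/- Let F and C be finite index types and let L̃ and L be symmetric positive definite real matrices indexed by F ⊕ C with L̃ ≈_ε L for some ε ≥ 0. Then SC(L̃, C) ≈_ε SC(L, C); that is, spectral approximation is preserved under taking Schur complements. -/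
open Matrix

/-- Extremal property of the Schur complement: for `L` with positive definite block `L_FF`,
subtracting `S` from the block `L_CC` leaves a positive semidefinite matrix iff
`S ⪯ SC(L, C)`. -/
theorem posSemidef_sub_fromBlocks_iff {F C : Type*} [Fintype F] [Fintype C] [DecidableEq F]
    {L : Matrix (F ⊕ C) (F ⊕ C) ℝ} (hL : L.PosDef) (S : Matrix C C ℝ) :
    (L - fromBlocks 0 0 0 S).PosSemidef ↔ loewnerLE S (schurC L) := by
  have hA : L.toBlocks₁₁.PosDef := hL.submatrix Sum.inl_injective
  have hB : L.toBlocks₂₁ = L.toBlocks₁₂ᴴ := by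
    ext i j
    exact (hL.isHermitian.apply _ _).symm
  have : Invertible L.toBlocks₁₁ := hA.isUnit.invertible
  have hsub : L - fromBlocks 0 0 0 S =
      fromBlocks L.toBlocks₁₁ L.toBlocks₁₂ L.toBlocks₁₂ᴴ (L.toBlocks₂₂ - S) := by
    conv_lhs => rw [← fromBlocks_toBlocks L, hB]
    simp [sub_eq_add_neg, fromBlocks_neg, fromBlocks_add]
  rw [hsub, hA.fromBlocks₁₁, loewnerLE, schurC, hB, sub_right_comm]

/-- The Schur complement is monotone in the Loewner order on positive definite matrices. -/
theorem schurC_mono {F C : Type*} [Fintype F] [Fintype C] [DecidableEq F]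
    {X Y : Matrix (F ⊕ C) (F ⊕ C) ℝ} (hX : X.PosDef) (hY : Y.PosDef) (h : loewnerLE X Y) :
    loewnerLE (schurC X) (schurC Y) := by
  have hX' : (X - fromBlocks 0 0 0 (schurC X)).PosSemidef :=
    (posSemidef_sub_fromBlocks_iff hX _).2 (by simp [loewnerLE, PosSemidef.zero])
  rw [← posSemidef_sub_fromBlocks_iff hY, ← sub_add_sub_cancel Y X]
  exact PosSemidef.add h hX'

/-- The Schur complement is homogeneous of degree one. -/
theorem schurC_smul {F C : Type*} [Fintype F] [DecidableEq F] {c : ℝ} (hc : c ≠ 0)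
    {L : Matrix (F ⊕ C) (F ⊕ C) ℝ} (hL : IsUnit L.toBlocks₁₁) :
    schurC (c • L) = c • schurC L := by
  have hinv : (c • L.toBlocks₁₁)⁻¹ = c⁻¹ • L.toBlocks₁₁⁻¹ :=
    inv_smul' L.toBlocks₁₁ (Units.mk0 c hc) ((isUnit_iff_isUnit_det _).1 hL)
  change c • L.toBlocks₂₂ - c • L.toBlocks₂₁ * (c • L.toBlocks₁₁)⁻¹ * c • L.toBlocks₁₂ = _
  rw [hinv, schurC, smul_sub]
  simp [smul_smul, hc]

/-- **Spectral approximation is preserved under taking Schur complements.**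
If `L̃` and `L` are symmetric positive definite matrices indexed by `F ⊕ C` with `L̃ ≈_ε L`
for some `ε ≥ 0`, then `SC(L̃, C) ≈_ε SC(L, C)`. -/
theorem schur_complement_specApprox {F C : Type*} [Fintype F] [Fintype C] [DecidableEq F]
    (ε : ℝ) (hε : 0 ≤ ε)
    (Lt L : Matrix (F ⊕ C) (F ⊕ C) ℝ) (hLt : Lt.PosDef) (hL : L.PosDef)
    (happrox : specApprox ε Lt L) :
    specApprox ε (schurC Lt) (schurC L) := by
  have hU : IsUnit L.toBlocks₁₁ := PosDef.isUnit (hL.submatrix Sum.inl_injective)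
  constructor
  · rw [← schurC_smul (Real.exp_ne_zero _) hU]
    exact schurC_mono (hL.smul (Real.exp_pos _)) hLt happrox.1
  · rw [← schurC_smul (Real.exp_ne_zero _) hU]
    exact schurC_mono hLt (hL.smul (Real.exp_pos _)) happrox.2
end

section
/- Let A be a symmetric positive definite real n×n matrix all of whose off-diagonal entries are nonpositive (a Stieltjes matrix). Then every entry of A⁻¹ is nonnegative. -/
open Matrix

/-- A real positive definite matrix with nonpositive off-diagonal entries is monotone:
`0 ≤ A *ᵥ x` forces `0 ≤ x`. -/
theorem nonneg_of_posDef_mulVec_nonneg {n : Type*} [Fintype n]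
    {A : Matrix n n ℝ} (hA : A.PosDef) (hoff : ∀ i j, i ≠ j → A i j ≤ 0)
    {x : n → ℝ} (hx : 0 ≤ A *ᵥ x) : 0 ≤ x := by
  have hcross : x⁻ ⬝ᵥ (A *ᵥ x⁺) ≤ 0 := by
    simp only [dotProduct, mulVec, Finset.mul_sum]
    refine Finset.sum_nonpos fun i _ => Finset.sum_nonpos fun j _ => ?_
    have hi : 0 ≤ x⁻ i := negPart_nonneg x i
    have hj : 0 ≤ x⁺ j := posPart_nonneg x j
    by_cases hij : i = j
    · subst hij
      rw [Pi.negPart_apply, Pi.posPart_apply]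
      rcases le_total 0 (x i) with h | h
      · simp [negPart_eq_zero.2 h]
      · simp [posPart_eq_zero.2 h]
    · exact mul_nonpos_of_nonneg_of_nonpos hi
        (mul_nonpos_of_nonpos_of_nonneg (hoff i j hij) hj)
  have hpair : 0 ≤ x⁻ ⬝ᵥ (A *ᵥ x) := dotProduct_nonneg_of_nonneg (negPart_nonneg x) hx
  have hsplit : x⁻ ⬝ᵥ (A *ᵥ x) = x⁻ ⬝ᵥ (A *ᵥ x⁺) - x⁻ ⬝ᵥ (A *ᵥ x⁻) := by
    rw [← dotProduct_sub, ← mulVec_sub, posPart_sub_negPart]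
  by_contra hneg
  have hpos := hA.dotProduct_mulVec_pos (x := x⁻) (mt negPart_eq_zero.1 hneg)
  rw [star_trivial] at hpos
  linarith

/-- **Inverses of Stieltjes matrices are entrywise nonnegative.**
If `A` is a symmetric positive definite real matrix all of whose off-diagonal entries are
nonpositive, then every entry of `A⁻¹` is nonnegative. -/
theorem stieltjes_inv_entrywise_nonneg {n : Type*} [Fintype n] [DecidableEq n]
    (A : Matrix n n ℝ) (hA : A.PosDef)
    (hoff : ∀ i j, i ≠ j → A i j ≤ 0) :
    ∀ i j, 0 ≤ A⁻¹ i j := by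
  intro i j
  have hdet : IsUnit A.det := A.isUnit_iff_isUnit_det.1 hA.isUnit
  have hcol : 0 ≤ A *ᵥ (A⁻¹ *ᵥ Pi.single j 1) := by
    rw [mulVec_mulVec, mul_nonsing_inv A hdet, one_mulVec]
    exact Pi.single_nonneg.2 zero_le_one
  simpa using nonneg_of_posDef_mulVec_nonneg hA hoff hcol i
end

section
/- Let G be a finite simple graph on n vertices admitting a tree decomposition of width at most τ. Then there exist pairwise disjoint vertex sets A, S, B with A ∪ S ∪ B = V(G) such that: no edge of G has one endpoint in A and the other in B; |S| ≤ τ + 1; |A| ≤ (2/3)·n and |B| ≤ (2/3)·n; and the induced subgraphs G[A ∪ S] and G[B ∪ S] each admit a tree decomposition of width at most τ. -/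
/-- `HasTreeDecompositionOfWidth G τ` : the simple graph `G` admits a tree decomposition of
width at most `τ`, i.e. a finite tree `T` with bags `X t ⊆ V` such that every vertex lies in
some bag, every edge has both endpoints in some common bag, for each vertex the set of tree
nodes whose bag contains it induces a connected (nonempty) subtree of `T`, and every bag has
at most `τ + 1` vertices. -/
def HasTreeDecompositionOfWidth {V : Type*} (G : SimpleGraph V) (τ : ℕ) : Prop :=
  ∃ (ι : Type) (_ : Fintype ι) (T : SimpleGraph ι) (X : ι → Finset V),
    T.IsTree ∧
    (∀ v : V, ∃ t, v ∈ X t) ∧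
    (∀ u v : V, G.Adj u v → ∃ t, u ∈ X t ∧ v ∈ X t) ∧
    (∀ v : V, (T.induce {t | v ∈ X t}).Connected) ∧
    (∀ t, (X t).card ≤ τ + 1)

/-- A tree decomposition of a graph restricts to every induced subgraph. -/
theorem HasTreeDecompositionOfWidth.induce {V : Type*} {G : SimpleGraph V} {τ : ℕ}
    (h : HasTreeDecompositionOfWidth G τ) (s : Set V) :
    HasTreeDecompositionOfWidth (G.induce s) τ := by
  classical
  obtain ⟨ι, hι, T, X, hT, hcov, hedge, hconn, hcard⟩ := h
  refine ⟨ι, hι, T, fun t => (X t).subtype (· ∈ s), hT, ?_, ?_, ?_, fun t => ?_⟩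
  · intro v
    simpa using hcov v
  · intro u v huv
    simpa using hedge u v huv
  · intro v
    have hnodes : {t | v ∈ (X t).subtype (· ∈ s)} = {t | (v : V) ∈ X t} := by
      ext t
      simp
    rw [hnodes]
    exact hconn v
  · rw [Finset.card_subtype]
    exact (Finset.card_filter_le _ _).trans (hcard t)

/-- The node `x` lies beyond the edge from `t` to `s`: some walk from `s` to `x` avoids `t`. -/
def SimpleGraph.Beyond {ι : Type*} (T : SimpleGraph ι) (t s x : ι) : Prop :=
  T.Adj t s ∧ ∃ p : T.Walk s x, t ∉ p.support

namespace SimpleGraph.Beyond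

variable {ι : Type*} {T : SimpleGraph ι} {t s s' x y : ι}

theorem ne (h : T.Beyond t s x) : x ≠ t := by
  obtain ⟨-, p, hp⟩ := h
  rintro rfl
  exact hp p.end_mem_support

theorem exists_path (h : T.Beyond t s x) :
    ∃ (hts : T.Adj t s) (p : T.Walk s x), (SimpleGraph.Walk.cons hts p).IsPath := by
  classical
  obtain ⟨hts, p, hp⟩ := h
  refine ⟨hts, p.bypass, ?_⟩
  rw [SimpleGraph.Walk.cons_isPath_iff]
  exact ⟨p.bypass_isPath, fun hmem => hp (p.support_bypass_subset_support hmem)⟩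

theorem unique (hT : T.IsAcyclic) (h : T.Beyond t s x) (h' : T.Beyond t s' x) : s = s' := by
  obtain ⟨hts, p, hp⟩ := h.exists_path
  obtain ⟨hts', p', hp'⟩ := h'.exists_path
  have := congrArg (fun q : T.Path t x => q.1.snd) ((hT.subsingleton_path t x).elim ⟨_, hp⟩ ⟨_, hp'⟩)
  simpa using this

theorem not_symm (hT : T.IsAcyclic) (h : T.Beyond t s x) : ¬ T.Beyond s t x := by
  intro h'
  obtain ⟨hts, p, hp⟩ := h.exists_path
  obtain ⟨hst, q, hq⟩ := h'.exists_path
  rw [SimpleGraph.Walk.cons_isPath_iff] at hq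
  have := congrArg (fun r : T.Path t x => r.1) ((hT.subsingleton_path t x).elim ⟨_, hp⟩ ⟨_, hq.1⟩)
  apply hq.2
  rw [← show SimpleGraph.Walk.cons hts p = q from this]
  simp

theorem trans_walk (h : T.Beyond t s x) (p : T.Walk x y) (hp : t ∉ p.support) :
    T.Beyond t s y := by
  obtain ⟨hts, q, hq⟩ := h
  refine ⟨hts, q.append p, ?_⟩
  rw [SimpleGraph.Walk.mem_support_append_iff]
  exact not_or.mpr ⟨hq, hp⟩

theorem of_induce_connected {S : Set ι} (hS : (T.induce S).Connected) (ht : t ∉ S)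
    (h : T.Beyond t s x) (hx : x ∈ S) (hy : y ∈ S) : T.Beyond t s y := by
  obtain ⟨p⟩ := hS.preconnected ⟨x, hx⟩ ⟨y, hy⟩
  let φ : T.induce S →g T := (SimpleGraph.Embedding.induce S).toHom
  refine h.trans_walk (p.map φ) fun hmem => ?_
  obtain ⟨z, -, rfl⟩ := List.mem_map.mp (SimpleGraph.Walk.support_map φ p ▸ hmem)
  exact ht z.2

end SimpleGraph.Beyond

theorem SimpleGraph.Connected.exists_beyond {ι : Type*} {T : SimpleGraph ι} (hT : T.Connected)
    {t x : ι} (h : x ≠ t) : ∃ s, T.Beyond t s x := by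
  obtain ⟨p, hp⟩ := hT.exists_isPath t x
  cases p with
  | nil => exact absurd rfl h
  | cons hts p => exact ⟨_, hts, p, ((SimpleGraph.Walk.cons_isPath_iff _ _).mp hp).2⟩

/-- If every node of a finite tree points to one of its neighbours, then some edge is pointed
along in both directions. -/
theorem SimpleGraph.IsTree.exists_apply_apply_eq {ι : Type*} [Fintype ι] {T : SimpleGraph ι}
    (hT : T.IsTree) (f : ι → ι) (hf : ∀ t, T.Adj t (f t)) : ∃ t, f (f t) = t := by
  classical
  by_contra! hne
  have hinj : Function.Injective fun t => s(t, f t) := by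
    intro t t' h
    rcases Sym2.eq_iff.mp h with ⟨h, -⟩ | ⟨h, h'⟩
    · exact h
    · exact absurd (by rw [h', ← h]) (hne t)
  have hle := Finset.card_le_card_of_injOn (s := Finset.univ) (t := T.edgeFinset)
    (fun t => s(t, f t)) (fun t _ => by simpa using hf t) hinj.injOn
  have := hT.card_edgeFinset
  rw [Finset.card_univ] at hle
  omega

/-- Weights of total at most `n`, each at most `n / 2`, split into two parts each of total at
most `2 n / 3`. -/
theorem Finset.exists_subset_balanced_sum {ι : Type*} [DecidableEq ι] (s : Finset ι) (w : ι → ℕ)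
    (n : ℕ) (hsum : ∑ i ∈ s, w i ≤ n) (hw : ∀ i ∈ s, 2 * w i ≤ n) :
    ∃ J ⊆ s, 3 * ∑ i ∈ J, w i ≤ 2 * n ∧ 3 * ∑ i ∈ s \ J, w i ≤ 2 * n := by
  by_cases hbig : ∃ i ∈ s, n ≤ 3 * w i
  · obtain ⟨i, hi, hin⟩ := hbig
    have hsplit := Finset.sum_sdiff (f := w) (Finset.singleton_subset_iff.mpr hi)
    have := hw i hi
    rw [Finset.sum_singleton] at hsplit
    refine ⟨{i}, by simpa using hi, ?_, ?_⟩
    · rw [Finset.sum_singleton]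
      omega
    · omega
  · push Not at hbig
    obtain ⟨J, hJ, hmax⟩ := Finset.exists_max_image
      (s.powerset.filter fun J => 3 * ∑ i ∈ J, w i ≤ 2 * n) Finset.card ⟨∅, by simp⟩
    rw [Finset.mem_filter, Finset.mem_powerset] at hJ
    refine ⟨J, hJ.1, hJ.2, ?_⟩
    have hsplit := Finset.sum_sdiff (f := w) hJ.1
    rcases (s \ J).eq_empty_or_nonempty with he | ⟨i, hi⟩
    · simp [he]
    · rw [Finset.mem_sdiff] at hi
      have hins : 2 * n < 3 * ∑ j ∈ insert i J, w j := by
        by_contra! hle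
        have := hmax (insert i J) (by
          rw [Finset.mem_filter, Finset.mem_powerset]
          exact ⟨Finset.insert_subset hi.1 hJ.1, hle⟩)
        rw [Finset.card_insert_of_notMem hi.2] at this
        omega
      rw [Finset.sum_insert hi.2] at hins
      have := hbig i hi.1
      omega

/-- **Balanced vertex separators from tree decompositions.**
If a finite simple graph `G` on `n` vertices admits a tree decomposition of width at most `τ`,
then there are pairwise disjoint vertex sets `A, S, B` covering all the vertices, with no edge
between `A` and `B`, `|S| ≤ τ + 1`, `|A| ≤ (2/3)n`, `|B| ≤ (2/3)n`, and such that the induced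
subgraphs `G[A ∪ S]` and `G[B ∪ S]` each admit a tree decomposition of width at most `τ`. -/
theorem balanced_separator_of_treewidth {V : Type*} [Fintype V] [DecidableEq V]
    (G : SimpleGraph V) (τ : ℕ)
    (hG : HasTreeDecompositionOfWidth G τ) :
    ∃ A S B : Finset V,
      Disjoint A S ∧ Disjoint A B ∧ Disjoint S B ∧
      A ∪ S ∪ B = Finset.univ ∧
      (∀ a ∈ A, ∀ b ∈ B, ¬ G.Adj a b) ∧
      S.card ≤ τ + 1 ∧
      (A.card : ℝ) ≤ 2 / 3 * Fintype.card V ∧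
      (B.card : ℝ) ≤ 2 / 3 * Fintype.card V ∧
      HasTreeDecompositionOfWidth (G.induce (↑(A ∪ S) : Set V)) τ ∧
      HasTreeDecompositionOfWidth (G.induce (↑(B ∪ S) : Set V)) τ := by
  classical
  have hind := fun s : Set V => hG.induce s
  obtain ⟨ι, _, T, X, hT, hcov, hedge, hconn, hcard⟩ := hG
  let N : ι → ι → Finset V := fun t s => {v | ∀ x, v ∈ X x → T.Beyond t s x}
  obtain ⟨t, ht⟩ : ∃ t, ∀ s, T.Adj t s → 2 * (N t s).card ≤ Fintype.card V := by
    by_contra! hbad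
    choose f hadj hbig using hbad
    obtain ⟨t, htt⟩ := hT.exists_apply_apply_eq f hadj
    have h₁ := hbig t
    have h₂ := hbig (f t)
    rw [htt] at h₂
    have hdisj : Disjoint (N t (f t)) (N (f t) t) := by
      rw [Finset.disjoint_left]
      intro v hv hv'
      obtain ⟨x, hx⟩ := hcov v
      exact ((Finset.mem_filter.mp hv).2 x hx).not_symm hT.isAcyclic
        ((Finset.mem_filter.mp hv').2 x hx)
    have := Finset.card_union_of_disjoint hdisj ▸ Finset.card_le_univ (N t (f t) ∪ N (f t) t)
    omega
  have hdir : ∀ v, ∃ s, v ∉ X t → ∀ x, v ∈ X x → T.Beyond t s x := by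
    intro v
    by_cases hv : v ∈ X t
    · exact ⟨t, fun h => absurd hv h⟩
    obtain ⟨x, hx⟩ := hcov v
    obtain ⟨s, hs⟩ := hT.connected.exists_beyond (t := t) (x := x) (by rintro rfl; exact hv hx)
    exact ⟨s, fun _ y hy => hs.of_induce_connected (hconn v) hv hx hy⟩
  choose d hd using hdir
  have hmaps (J : Finset ι) : ({v | v ∉ X t ∧ d v ∈ J} : Finset V).card =
      ∑ s ∈ J, ({v | v ∉ X t ∧ d v = s} : Finset V).card := by
    rw [Finset.card_eq_sum_card_fiberwise (f := d) (t := J)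
      (fun v hv => (Finset.mem_filter.mp hv).2.2)]
    refine Finset.sum_congr rfl fun s hs => ?_
    congr 1
    ext v
    simp only [Finset.mem_filter, Finset.mem_univ, true_and]
    constructor
    · exact fun h => ⟨h.1.1, h.2⟩
    · rintro ⟨h, rfl⟩
      exact ⟨⟨h, hs⟩, rfl⟩
  obtain ⟨J, -, hJ, hJc⟩ := Finset.exists_subset_balanced_sum Finset.univ
    (fun s => ({v | v ∉ X t ∧ d v = s} : Finset V).card) (Fintype.card V)
    (by rw [← hmaps]; exact Finset.card_le_univ _) (by
      intro s _
      rcases ({v | v ∉ X t ∧ d v = s} : Finset V).eq_empty_or_nonempty with he | ⟨v, hv⟩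
      · simp [he]
      · obtain ⟨hvt, rfl⟩ := (Finset.mem_filter.mp hv).2
        obtain ⟨x, hx⟩ := hcov v
        refine le_trans (Nat.mul_le_mul_left 2 (Finset.card_le_card fun u hu => ?_))
          (ht (d v) (hd v hvt x hx).1)
        obtain ⟨hu, huv⟩ := (Finset.mem_filter.mp hu).2
        exact Finset.mem_filter.mpr ⟨Finset.mem_univ u, huv ▸ hd u hu⟩)
  rw [← hmaps] at hJ hJc
  have hreal {a : ℕ} (ha : 3 * a ≤ 2 * Fintype.card V) : (a : ℝ) ≤ 2 / 3 * Fintype.card V := by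
    have : (3 * a : ℝ) ≤ 2 * Fintype.card V := by exact_mod_cast ha
    linarith
  refine ⟨({v | v ∉ X t ∧ d v ∈ J} : Finset V), X t,
    ({v | v ∉ X t ∧ d v ∈ Finset.univ \ J} : Finset V), ?_, ?_, ?_, ?_, ?_,
    hcard t, hreal hJ, hreal hJc, hind _, hind _⟩
  · rw [Finset.disjoint_left]
    intro v hv
    exact (Finset.mem_filter.mp hv).2.1
  · rw [Finset.disjoint_left]
    intro v hv hv'
    exact (Finset.mem_sdiff.mp (Finset.mem_filter.mp hv').2.2).2 (Finset.mem_filter.mp hv).2.2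
  · rw [Finset.disjoint_right]
    intro v hv
    exact (Finset.mem_filter.mp hv).2.1
  · ext v
    simp only [Finset.mem_union, Finset.mem_filter, Finset.mem_univ, Finset.mem_sdiff]
    tauto
  · intro a ha b hb hab
    obtain ⟨ha, haJ⟩ := (Finset.mem_filter.mp ha).2
    obtain ⟨hb, hbJ⟩ := (Finset.mem_filter.mp hb).2
    obtain ⟨x, hax, hbx⟩ := hedge a b hab
    have := (hd a ha x hax).unique hT.isAcyclic (hd b hb x hbx)
    exact (Finset.mem_sdiff.mp hbJ).2 (this ▸ haJ)
end

section
/- Let G be a finite directed graph with vertex set V and edge set E, and let B ∈ ℝ^{E×V} be its edge-vertex incidence matrix, where for each edge e = (u, v) the row B_e has entry +1 in column v, entry -1 in column u, and 0 elsewhere. Let l, u ∈ ℤ^E with l ≤ u, let b ∈ ℤ^V, and suppose the polytope P = { f ∈ ℝ^E : Bᵀ f = b, l ≤ f ≤ u } is nonempty. Then for every cost vector c ∈ ℝ^E there exists an integral vector f* ∈ ℤ^E with f* ∈ P such that cᵀ f* ≤ cᵀ f for all f ∈ P; that is, the minimum cost over P is attained at an integral flow. -/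
open Matrix

/-- A matrix with vanishing column sums and at least as many columns as rows has a nontrivial
kernel. -/
theorem exists_ne_zero_mulVec_eq_zero_of_colSum_eq_zero {m n : Type*} [Fintype m] [Fintype n]
    [Nonempty m] (M : Matrix m n ℝ) (hM : ∀ j, ∑ i, M i j = 0)
    (hcard : Fintype.card m ≤ Fintype.card n) : ∃ w : n → ℝ, w ≠ 0 ∧ M *ᵥ w = 0 := by
  classical
  by_contra! h
  have hker : LinearMap.ker M.mulVecLin = ⊥ :=
    (Submodule.eq_bot_iff _).2 fun w hw => by_contra fun hne => h w hne (by simpa using hw)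
  have hlt : Module.finrank ℝ (LinearMap.range M.mulVecLin) < Module.finrank ℝ (m → ℝ) := by
    refine Submodule.finrank_lt fun htop => ?_
    obtain ⟨i⟩ := ‹Nonempty m›
    have hi : Pi.single i (1 : ℝ) ∈ LinearMap.range M.mulVecLin := htop ▸ Submodule.mem_top
    obtain ⟨w, hw⟩ := hi
    have hsum : ∑ k, (M *ᵥ w) k = 0 := by
      simp only [mulVec, dotProduct]
      rw [Finset.sum_comm]
      simp [← Finset.sum_mul, hM]
    rw [← mulVecLin_apply, hw] at hsum
    simp at hsum
  rw [LinearMap.finrank_range_of_inj (LinearMap.ker_eq_bot.1 hker)] at hlt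
  simp only [Module.finrank_fintype_fun_eq_card] at hlt
  omega

/-- If a flow with integral demands is fractional exactly on the nonempty edge set `F`, then `F`
supports a nonzero circulation. -/
theorem exists_circulation_of_fractional {V E : Type*} [Fintype V] [Fintype E] [DecidableEq V]
    (src tgt : E → V) (hst : ∀ e, src e ≠ tgt e) (B : Matrix E V ℝ)
    (hB : ∀ e v, B e v = (if v = tgt e then (1 : ℝ) else 0) - (if v = src e then 1 else 0))
    (b : V → ℤ) (f : E → ℝ) (hf : Bᵀ *ᵥ f = fun v => (b v : ℝ))
    (F : Finset E) (hF : ∀ e, e ∈ F ↔ f e ∉ (Int.castRingHom ℝ).range) (hne : F.Nonempty) :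
    ∃ z : E → ℝ, z ≠ 0 ∧ Bᵀ *ᵥ z = 0 ∧ ∀ e ∉ F, z e = 0 := by
  classical
  set R := (Int.castRingHom ℝ).range
  let inc : V → E → Prop := fun v e => v = src e ∨ v = tgt e
  let T : Finset V := {v | ∃ e ∈ F, inc v e}
  have hBR : ∀ e v, B e v ∈ R := fun e v => by
    rw [hB]
    refine R.sub_mem ?_ ?_ <;> split_ifs <;> simp [R.one_mem, R.zero_mem]
  have hB0 : ∀ e v, ¬ inc v e → B e v = 0 := fun e v h => by
    simp only [inc, not_or] at h
    simp [hB, h.1, h.2]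
  have hdeg : ∀ v ∈ T, 2 ≤ (F.bipartiteAbove inc v).card := by
    intro v hv
    obtain ⟨e₀, he₀, hinc⟩ : ∃ e ∈ F, inc v e := by simpa [T] using hv
    by_contra! hlt
    have honly : ∀ e ∈ F, inc v e → e = e₀ := fun e he hi =>
      Finset.card_le_one.1 (Nat.lt_succ_iff.1 hlt) e (by simp [he, hi]) e₀ (by simp [he₀, hinc])
    have hbal : ∑ e, B e v * f e = b v := by
      simpa [mulVec, dotProduct] using congrFun hf v
    rw [← Finset.add_sum_erase _ _ (Finset.mem_univ e₀)] at hbal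
    have hrest : ∑ e ∈ Finset.univ.erase e₀, B e v * f e ∈ R := by
      refine R.sum_mem fun e he => ?_
      by_cases heF : e ∈ F
      · rw [hB0 e v fun hi => (Finset.ne_of_mem_erase he) (honly e heF hi), zero_mul]
        exact R.zero_mem
      · exact R.mul_mem (hBR e v) (by_contra fun h => heF ((hF e).2 h))
    have hmem : B e₀ v * f e₀ ∈ R := by
      rw [eq_sub_of_add_eq hbal]
      exact R.sub_mem ⟨b v, by simp⟩ hrest
    have hsq : B e₀ v * (B e₀ v * f e₀) = f e₀ := by
      rw [hB]
      rcases hinc with h | h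
      · simp [h, hst e₀]
      · simp [h, (hst e₀).symm]
    exact (hF e₀).1 he₀ (hsq ▸ R.mul_mem (hBR e₀ v) hmem)
  have hcard : T.card * 2 ≤ F.card * 2 := by
    refine Finset.card_mul_le_card_mul inc hdeg fun e _ => ?_
    refine (Finset.card_le_card (t := {src e, tgt e}) fun v hv => ?_).trans Finset.card_le_two
    simpa [inc] using ((Finset.mem_bipartiteBelow inc).1 hv).2
  have hsT : ∀ e ∈ F, src e ∈ T := fun e he => by simpa [T] using ⟨e, he, Or.inl rfl⟩
  have htT : ∀ e ∈ F, tgt e ∈ T := fun e he => by simpa [T] using ⟨e, he, Or.inr rfl⟩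
  obtain ⟨e₁, he₁⟩ := hne
  have : Nonempty T := ⟨⟨src e₁, hsT e₁ he₁⟩⟩
  obtain ⟨w, hw0, hw⟩ := exists_ne_zero_mulVec_eq_zero_of_colSum_eq_zero
    (Matrix.of fun (v : T) (e : F) => B e v)
    (fun e => by
      simp only [of_apply]
      rw [Finset.sum_coe_sort T fun v => B e v]
      simp [hB, hsT e e.2, htT e e.2])
    (by simpa using hcard)
  refine ⟨fun e => if h : e ∈ F then w ⟨e, h⟩ else 0, fun h => hw0 ?_, ?_, fun e he => by simp [he]⟩
  · ext e
    simpa using congrFun h e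
  · ext v
    have hsum : (Bᵀ *ᵥ fun e => if h : e ∈ F then w ⟨e, h⟩ else 0) v = ∑ e : F, B e v * w e := by
      simp only [mulVec, dotProduct, transpose_apply]
      rw [← Finset.sum_subset F.subset_univ fun e _ he => by simp [he], ← Finset.sum_coe_sort F]
      simp
    rw [hsum]
    by_cases hv : v ∈ T
    · simpa [mulVec, dotProduct] using congrFun hw ⟨v, hv⟩
    · refine Finset.sum_eq_zero fun e _ => ?_
      rw [hB0 e v fun hi => hv (by simpa [T] using ⟨e.1, e.2, hi⟩), zero_mul]

/-- Extreme points of a flow polytope with integral data are integral. -/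
theorem integral_of_mem_extremePoints_flow {V E : Type*} [Fintype V] [Fintype E] [DecidableEq V]
    (src tgt : E → V) (hst : ∀ e, src e ≠ tgt e) (B : Matrix E V ℝ)
    (hB : ∀ e v, B e v = (if v = tgt e then (1 : ℝ) else 0) - (if v = src e then 1 else 0))
    (l u : E → ℤ) (b : V → ℤ) {f : E → ℝ}
    (hf : f ∈ Set.extremePoints ℝ { f : E → ℝ | Bᵀ *ᵥ f = (fun v => (b v : ℝ)) ∧
        ∀ e, (l e : ℝ) ≤ f e ∧ f e ≤ (u e : ℝ) }) (e : E) :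
    f e ∈ (Int.castRingHom ℝ).range := by
  classical
  by_contra he
  obtain ⟨⟨hfb, hbd⟩, hext⟩ := hf
  obtain ⟨z, hz0, hz, hsupp⟩ := exists_circulation_of_fractional src tgt hst B hB b f hfb
    {e | f e ∉ (Int.castRingHom ℝ).range} (by simp) ⟨e, by simpa using he⟩
  have hev : ∀ᶠ t : ℝ in nhds 0, ∀ e, (l e : ℝ) ≤ f e + t * z e ∧ f e + t * z e ≤ u e := by
    refine Filter.eventually_all.2 fun e => ?_
    by_cases hfe : f e ∈ (Int.castRingHom ℝ).range
    · simpa [hsupp e (by simpa using hfe)] using hbd e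
    · have hl : (l e : ℝ) < f e := (hbd e).1.lt_of_ne fun h => hfe ⟨l e, by simpa using h⟩
      have hu : f e < u e := (hbd e).2.lt_of_ne fun h => hfe ⟨u e, by simpa using h.symm⟩
      have hcont : Filter.Tendsto (fun t : ℝ => f e + t * z e) (nhds 0) (nhds (f e)) := by
        have : Continuous fun t : ℝ => f e + t * z e := by fun_prop
        simpa using this.tendsto 0
      filter_upwards [hcont.eventually_const_lt hl, hcont.eventually_lt_const hu] with t h₁ h₂
      exact ⟨h₁.le, h₂.le⟩
  obtain ⟨ε, hε, hball⟩ := Metric.eventually_nhds_iff.1 hev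
  have hmem : ∀ t : ℝ, |t| < ε → f + t • z ∈ { f : E → ℝ | Bᵀ *ᵥ f = (fun v => (b v : ℝ)) ∧
      ∀ e, (l e : ℝ) ≤ f e ∧ f e ≤ (u e : ℝ) } := fun t ht =>
    ⟨by rw [mulVec_add, mulVec_smul, hz, hfb, smul_zero, add_zero],
      hball (by simpa [Real.dist_eq] using ht)⟩
  have hhalf : |ε / 2| < ε := by rw [abs_of_pos (by positivity)]; linarith
  have heq := hext (hmem (ε / 2) hhalf) (hmem (-(ε / 2)) (by rwa [abs_neg]))
    ⟨1 / 2, 1 / 2, by norm_num, by norm_num, by norm_num, by module⟩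
  have hzero : (ε / 2) • z = 0 := by simpa using heq
  exact (smul_ne_zero (by positivity) hz0) hzero

/-- **Min-cost flow polytopes have integral optima.**
Let `B` be the edge–vertex incidence matrix of a finite directed graph (row `B e` has entry
`+1` at the head `tgt e`, `-1` at the tail `src e`, and `0` elsewhere), let `l ≤ u` be integral
capacity vectors and `b` an integral demand vector, and suppose the flow polytope
`P = { f : Bᵀ f = b, l ≤ f ≤ u }` is nonempty. Then for every cost vector `c` there is an
integral `f* ∈ P` minimizing `cᵀ f` over `P`. -/
theorem min_cost_flow_integral_optimum {V E : Type*} [Fintype V] [Fintype E] [DecidableEq V]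
    (src tgt : E → V) (hst : ∀ e, src e ≠ tgt e)
    (B : Matrix E V ℝ)
    (hB : ∀ e v, B e v = (if v = tgt e then (1 : ℝ) else 0) - (if v = src e then 1 else 0))
    (l u : E → ℤ) (hlu : ∀ e, l e ≤ u e) (b : V → ℤ)
    (P : Set (E → ℝ))
    (hP : P = { f : E → ℝ | Bᵀ *ᵥ f = (fun v => (b v : ℝ)) ∧
        ∀ e, (l e : ℝ) ≤ f e ∧ f e ≤ (u e : ℝ) })
    (hne : P.Nonempty) (c : E → ℝ) :
    ∃ g : E → ℤ, (fun e => (g e : ℝ)) ∈ P ∧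
      ∀ f ∈ P, c ⬝ᵥ (fun e => (g e : ℝ)) ≤ c ⬝ᵥ f := by
  have hcomp : IsCompact P := by
    have hPeq : P = {f | Bᵀ *ᵥ f = fun v => (b v : ℝ)} ∩
        Set.Icc (fun e => (l e : ℝ)) (fun e => (u e : ℝ)) := by
      ext f
      simp [hP, Pi.le_def, forall_and]
    rw [hPeq]
    exact isCompact_Icc.inter_left
      (isClosed_eq (Continuous.matrix_mulVec continuous_const continuous_id) continuous_const)
  let φ : (E → ℝ) →L[ℝ] ℝ := LinearMap.toContinuousLinearMap (-(dotProductBilin ℝ ℝ c))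
  have hφ : ∀ f, φ f = -(c ⬝ᵥ f) := fun f => rfl
  have hexp : IsExposed ℝ P (φ.toExposed P) := ContinuousLinearMap.toExposed.isExposed
  obtain ⟨f₀, hf₀, hmax⟩ := hcomp.exists_isMaxOn hne φ.continuous.continuousOn
  obtain ⟨f, hf⟩ := (hexp.isCompact hcomp).extremePoints_nonempty ⟨f₀, hf₀, hmax⟩
  have hfP : f ∈ Set.extremePoints ℝ P :=
    hexp.isExtreme.extremePoints_subset_extremePoints hf
  choose g hg using integral_of_mem_extremePoints_flow src tgt hst B hB l u b (hP ▸ hfP)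
  have hgf : (fun e => (g e : ℝ)) = f := funext hg
  refine ⟨g, hgf ▸ hfP.1, fun f' hf' => ?_⟩
  rw [hgf]
  have := hf.1.2 f' hf'
  rw [hφ, hφ] at this
  linarith
end
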